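/- For every n ∈ ℕ and p ∈ [0,1], the law of G⃗(n,p) equals the law of the random directed graph obtained as follows: sample G(n,p); orient each of its edges in the increasing direction of the depth-first order v₀,…,v_{n−1} produced by the depth-first exploration of G(n,p); then add each possible back edge (v_i, v_j) with j < i independently with probability p. -/

import Mathlib

/-!
The forward depth-first forest of the random directed graph `G⃗(n,p)` has the same
distribution as the depth-first forest of the Erdős–Rényi graph `G(n,p)`.

Graphs on `[n] = {1,…,n}` are encoded as functions `Fin n → Fin n → Bool` (adjacency,
`d u w = true` meaning there is a (directed) edge from `u` to `w`); vertex `1` corresponds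
to `(0 : Fin n)` and the increasing order on labels is the order on `Fin n`.
-/

open Finset

namespace DFSExploration

/-- The state of the depth-first exploration: the ordered stack `𝒪ᵢ` of open vertices, the
list of explored vertices (in order of exploration), and the list of forest edges found. -/
structure State (n : ℕ) where
  stack : List (Fin n)
  visited : List (Fin n)
  forest : List (Fin n × Fin n)

/-- One step of the depth-first exploration of the (directed) graph with adjacency `adj`:
the first vertex `v` of the stack is explored; its (out-)neighbours which have not been
seen yet are added at the front of the stack, in increasing order; if the stack becomes
empty, the smallest unexplored vertex is put on it. -/
def step {n : ℕ} (adj : Fin n → Fin n → Bool) (s : State n) : State n :=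
  match s.stack with
  | [] => s
  | v :: rest =>
    let visited' := s.visited ++ [v]
    let ns := (List.finRange n).filter
      (fun w => adj v w && !(decide (w ∈ s.stack)) && !(decide (w ∈ s.visited)))
    let stack' := ns ++ rest
    let stack'' := if stack'.isEmpty then
        ((List.finRange n).filter (fun w => !(decide (w ∈ visited')))).take 1
      else stack'
    ⟨stack'', visited', s.forest ++ ns.map (fun w => (v, w))⟩

/-- The result of running the depth-first exploration, started from vertex `1`
(i.e. `0 : Fin n`). -/
def run {n : ℕ} (adj : Fin n → Fin n → Bool) : State n :=
  (step adj)^[n] ⟨(List.finRange n).take 1, [], []⟩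

/-- The depth-first forest of a graph, as the list of its edges `(vᵢ, w)`, `w ∈ 𝒩ᵢ`, in
order of appearance.  For a directed graph this is the forward depth-first forest
`F_{G⃗}`; for an undirected graph (symmetric adjacency function) it is the depth-first
forest `F_G`. -/
def dfsForest {n : ℕ} (adj : Fin n → Fin n → Bool) : List (Fin n × Fin n) :=
  (run adj).forest

/-- The probability that the random directed graph `G⃗(n,p)` (each of the `n(n-1)` possible
directed edges present independently with probability `p`) equals a given directed graph
`d`; it is `0` if `d` has a self-loop. -/
noncomputable def dirProb (n : ℕ) (p : ℝ) (d : Fin n → Fin n → Bool) : ℝ :=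
  if ∀ i, d i i = false then
    ∏ x ∈ univ.filter (fun x : Fin n × Fin n => x.1 ≠ x.2),
      (if d x.1 x.2 then p else 1 - p)
  else 0

/-- The probability that the Erdős–Rényi graph `G(n,p)` (each of the `n(n-1)/2` possible
undirected edges present independently with probability `p`) equals a given undirected
graph `g` (encoded as a symmetric irreflexive adjacency function); it is `0` if `g` is not
symmetric irreflexive. -/
noncomputable def undirProb (n : ℕ) (p : ℝ) (g : Fin n → Fin n → Bool) : ℝ :=
  if (∀ i, g i i = false) ∧ (∀ i j, g i j = g j i) then
    ∏ x ∈ univ.filter (fun x : Fin n × Fin n => x.1 < x.2),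
      (if g x.1 x.2 then p else 1 - p)
  else 0


/-- The position of a vertex in the depth-first order `v₀, v₁, …, v_{n-1}`. -/
def dfsPos {n : ℕ} (adj : Fin n → Fin n → Bool) (v : Fin n) : ℕ :=
  (run adj).visited.findIdx (fun w => decide (w = v))

/-- The probability weight of a configuration `b` of back edges, given the undirected
graph `g`: each possible back edge `(vᵢ, vⱼ)` with `j < i` (for the depth-first order
of `g`) is present independently with probability `p`; configurations containing a
non-back edge get weight `0`. -/
noncomputable def backProb (n : ℕ) (p : ℝ) (g : Fin n → Fin n → Bool)
    (b : Fin n → Fin n → Bool) : ℝ :=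
  if ∀ u w, b u w = true → dfsPos g w < dfsPos g u then
    ∏ x ∈ univ.filter (fun x : Fin n × Fin n => dfsPos g x.2 < dfsPos g x.1),
      (if b x.1 x.2 then p else 1 - p)
  else 0

/-- The directed graph obtained from the undirected graph `g` by orienting each of its
edges in the increasing direction of the depth-first order of `g`, and adding the back
edges given by `b`. -/
def orientPlusBack {n : ℕ} (g : Fin n → Fin n → Bool) (b : Fin n → Fin n → Bool) :
    Fin n → Fin n → Bool :=
  fun u w => (g u w && decide (dfsPos g u < dfsPos g w)) || b u w

end DFSExploration

namespace DFSExploration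

variable {n : ℕ}

/-- The state of the exploration after `k` steps. -/
def stateAfter (adj : Fin n → Fin n → Bool) (k : ℕ) : State n :=
  (step adj)^[k] ⟨(List.finRange n).take 1, [], []⟩

theorem stateAfter_succ (adj : Fin n → Fin n → Bool) (k : ℕ) :
    stateAfter adj (k + 1) = step adj (stateAfter adj k) := by
  simp only [stateAfter, Function.iterate_succ_apply']

/-- The unexplored stack and the explored vertices are disjoint and duplicate-free, and the
stack is empty only when every vertex has been explored. -/
def State.IsValid (s : State n) : Prop :=
  (s.visited ++ s.stack).Nodup ∧ (s.stack = [] → ∀ w, w ∈ s.visited)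

theorem step_visited_of_cons (adj : Fin n → Fin n → Bool) (s : State n) {v : Fin n}
    {rest : List (Fin n)} (h : s.stack = v :: rest) :
    (step adj s).visited = s.visited ++ [v] := by
  simp [step, h]

theorem State.IsValid.step {s : State n} (hs : s.IsValid) (adj : Fin n → Fin n → Bool) :
    (step adj s).IsValid := by
  obtain ⟨st, vis, fo⟩ := s
  cases st with
  | nil => exact hs
  | cons v rest =>
    obtain ⟨hnd, -⟩ := hs
    simp only [List.nodup_append, List.nodup_cons, List.mem_cons] at hnd
    obtain ⟨hvis, ⟨hv, hrest⟩, hdisj⟩ := hnd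
    simp only [State.IsValid, DFSExploration.step]
    split_ifs with hemp
    · constructor
      · rw [List.nodup_append]
        refine ⟨?_, ((List.nodup_finRange n).filter _).sublist (List.take_sublist _ _), ?_⟩
        · rw [List.nodup_append]
          refine ⟨hvis, List.nodup_singleton v, ?_⟩
          intro a ha b hb
          exact hdisj a ha b (Or.inl (by simpa using hb))
        · rintro a ha b hb rfl
          have := List.mem_of_mem_take hb
          rw [List.mem_filter] at this
          simp only [List.mem_finRange, Bool.not_eq_true', decide_eq_false_iff_not] at this
          exact this.2 ha
      · intro h w
        rw [List.take_eq_nil_iff] at h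
        rcases h with h | h
        · omega
        · rw [List.filter_eq_nil_iff] at h
          have := h w (List.mem_finRange w)
          simpa [or_iff_not_imp_left] using this
    · constructor
      · simp only [List.nodup_append, List.nodup_singleton, List.mem_append, List.mem_filter,
          List.mem_finRange, List.mem_cons, List.not_mem_nil, or_false]
        refine ⟨⟨hvis, trivial, ?_⟩, ⟨(List.nodup_finRange n).filter _, hrest, ?_⟩, ?_⟩
        · rintro a ha b rfl
          exact hdisj a ha b (Or.inl rfl)
        · rintro a ha b hb rfl
          simp [hb] at ha
        · rintro a ha b hb rfl
          rcases ha with ha | rfl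
          · rcases hb with hb | hb
            · simp [ha] at hb
            · exact hdisj a ha a (Or.inr hb) rfl
          · rcases hb with hb | hb
            · simp at hb
            · exact hv hb
      · intro h
        exact absurd (List.isEmpty_iff.mpr h) hemp

theorem stateAfter_isValid (adj : Fin n → Fin n → Bool) (k : ℕ) :
    (stateAfter adj k).IsValid := by
  induction k with
  | zero =>
    refine ⟨?_, ?_⟩
    · simpa [stateAfter] using (List.nodup_finRange n).sublist (List.take_sublist _ _)
    · intro h w
      rcases List.take_eq_nil_iff.mp h with h | h
      · omega
      · have := List.mem_finRange w
        simp [h] at this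
  | succ k ih =>
    rw [stateAfter_succ]
    exact ih.step adj

theorem stateAfter_visited_prefix (adj : Fin n → Fin n → Bool) {k m : ℕ} (h : k ≤ m) :
    (stateAfter adj k).visited <+: (stateAfter adj m).visited := by
  induction m, h using Nat.le_induction with
  | base => exact List.prefix_rfl
  | succ m _ ih =>
    refine ih.trans ?_
    rw [stateAfter_succ]
    cases hst : (stateAfter adj m).stack with
    | nil => simp [step, hst]
    | cons v rest =>
      rw [step_visited_of_cons adj _ hst]
      exact List.prefix_append _ _

theorem stateAfter_visited_length_or (adj : Fin n → Fin n → Bool) (k : ℕ) :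
    (stateAfter adj k).visited.length = k ∨ ∀ w, w ∈ (stateAfter adj k).visited := by
  induction k with
  | zero => exact Or.inl rfl
  | succ k ih =>
    cases hst : (stateAfter adj k).stack with
    | nil =>
      right
      intro w
      exact (stateAfter_visited_prefix adj k.le_succ).subset
        ((stateAfter_isValid adj k).2 hst w)
    | cons v rest =>
      rcases ih with ih | ih
      · left
        rw [stateAfter_succ, step_visited_of_cons adj _ hst]
        simp [ih]
      · right
        intro w
        exact (stateAfter_visited_prefix adj k.le_succ).subset (ih w)

theorem mem_run_visited (adj : Fin n → Fin n → Bool) (w : Fin n) :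
    w ∈ (run adj).visited := by
  rcases stateAfter_visited_length_or adj n with h | h
  · have hnd : (stateAfter adj n).visited.Nodup :=
      (List.nodup_append.mp (stateAfter_isValid adj n).1).1
    have hcard : (stateAfter adj n).visited.toFinset = univ := by
      rw [← Finset.card_eq_iff_eq_univ, List.toFinset_card_of_nodup hnd, h, Fintype.card_fin]
    have : w ∈ (stateAfter adj n).visited.toFinset := hcard ▸ mem_univ w
    exact List.mem_toFinset.mp this
  · exact h w

theorem dfsPos_injective (adj : Fin n → Fin n → Bool) : Function.Injective (dfsPos adj) := by
  have key : ∀ v, (run adj).visited[dfsPos adj v]? = some v := by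
    intro v
    have hlt : dfsPos adj v < (run adj).visited.length :=
      List.findIdx_lt_length_of_exists ⟨v, mem_run_visited adj v, by simp⟩
    rw [List.getElem?_eq_getElem hlt]
    exact congrArg some (of_decide_eq_true
      (List.findIdx_getElem (p := fun w => decide (w = v)) (w := hlt)))
  intro u v h
  have := key u
  rw [h, key v] at this
  exact (Option.some.inj this).symm

theorem dfsPos_lt_of_prefix {adj : Fin n → Fin n → Bool} {l : List (Fin n)} {v w : Fin n}
    (hl : l <+: (run adj).visited) (hv : v ∈ l) (hw : w ∉ l) : dfsPos adj v < dfsPos adj w := by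
  obtain ⟨t, ht⟩ := hl
  have h1 : l.findIdx (fun x => decide (x = v)) < l.length :=
    List.findIdx_lt_length_of_exists ⟨v, hv, by simp⟩
  have h2 : l.findIdx (fun x => decide (x = w)) = l.length := by
    rw [List.findIdx_eq_length]
    intro x hx
    simp only [decide_eq_false_iff_not]
    rintro rfl
    exact hw hx
  rw [dfsPos, dfsPos, ← ht, List.findIdx_append, List.findIdx_append, if_pos h1, h2,
    if_neg (lt_irrefl _)]
  omega

/-- The exploration only depends on the edges oriented along the order it produces. -/
theorem run_congr {adj adj' : Fin n → Fin n → Bool}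
    (h : ∀ u w, dfsPos adj u < dfsPos adj w → adj u w = adj' u w) : run adj = run adj' := by
  suffices H : ∀ k ≤ n, stateAfter adj k = stateAfter adj' k from H n le_rfl
  intro k
  induction k with
  | zero => intro _; rfl
  | succ k ih =>
    intro hk
    rw [stateAfter_succ, stateAfter_succ, ← ih (by omega)]
    cases hst : (stateAfter adj k).stack with
    | nil => simp [step, hst]
    | cons v rest =>
      have hpre := stateAfter_visited_prefix adj hk
      rw [stateAfter_succ, step_visited_of_cons adj _ hst] at hpre
      have hns : (List.finRange n).filter (fun w => adj v w &&
            !(decide (w ∈ v :: rest)) && !(decide (w ∈ (stateAfter adj k).visited))) =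
          (List.finRange n).filter (fun w => adj' v w &&
            !(decide (w ∈ v :: rest)) && !(decide (w ∈ (stateAfter adj k).visited))) := by
        refine List.filter_congr fun w _ => ?_
        by_cases h1 : w ∈ v :: rest
        · simp only [h1, decide_true, Bool.not_true, Bool.and_false]
        by_cases h2 : w ∈ (stateAfter adj k).visited
        · simp only [h2, decide_true, Bool.not_true, Bool.and_false]
        have hw : w ∉ (stateAfter adj k).visited ++ [v] := by
          simp only [List.mem_cons, not_or] at h1
          simp [h1.1, h2]
        rw [h v w (dfsPos_lt_of_prefix hpre (by simp) hw)]
      simp only [step, hst, hns]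

theorem dfsPos_congr {adj adj' : Fin n → Fin n → Bool}
    (h : ∀ u w, dfsPos adj u < dfsPos adj w → adj u w = adj' u w) :
    dfsPos adj = dfsPos adj' := by
  funext v
  simp only [dfsPos, run_congr h]

/-- The undirected graph carried by the edges of `d` that are increasing for the depth-first
order of `d`. -/
def forwardGraph (d : Fin n → Fin n → Bool) : Fin n → Fin n → Bool :=
  fun u w => if dfsPos d u < dfsPos d w then d u w
    else if dfsPos d w < dfsPos d u then d w u else false

/-- The edges of `d` that are decreasing for the depth-first order of `d`. -/
def backEdges (d : Fin n → Fin n → Bool) : Fin n → Fin n → Bool :=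
  fun u w => decide (dfsPos d w < dfsPos d u) && d u w

theorem dfsPos_forwardGraph (d : Fin n → Fin n → Bool) :
    dfsPos (forwardGraph d) = dfsPos d :=
  (dfsPos_congr fun u w h => by simp [forwardGraph, h]).symm

theorem forwardGraph_irrefl (d : Fin n → Fin n → Bool) (i : Fin n) :
    forwardGraph d i i = false := by
  simp [forwardGraph]

theorem forwardGraph_symm (d : Fin n → Fin n → Bool) (i j : Fin n) :
    forwardGraph d i j = forwardGraph d j i := by
  rcases lt_trichotomy (dfsPos d i) (dfsPos d j) with h | h | h <;>
    simp [forwardGraph, h, h.le]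

theorem orientPlusBack_forwardGraph {d : Fin n → Fin n → Bool} (hd : ∀ i, d i i = false) :
    orientPlusBack (forwardGraph d) (backEdges d) = d := by
  funext u w
  simp only [orientPlusBack, dfsPos_forwardGraph]
  rcases lt_trichotomy (dfsPos d u) (dfsPos d w) with h | h | h
  · simp [forwardGraph, backEdges, h, h.le]
  · obtain rfl := dfsPos_injective d h
    simp [backEdges, hd]
  · simp [backEdges, h, h.le]

theorem dfsPos_orientPlusBack {g b : Fin n → Fin n → Bool}
    (hb : ∀ u w, b u w = true → dfsPos g w < dfsPos g u) :
    dfsPos (orientPlusBack g b) = dfsPos g := by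
  refine (dfsPos_congr fun u w h => ?_).symm
  have : b u w = false := by
    by_contra hc
    exact absurd (hb u w (by simpa using hc)) h.asymm
  simp [orientPlusBack, h, this]

theorem forwardGraph_orientPlusBack {g b : Fin n → Fin n → Bool} (hg : ∀ i, g i i = false)
    (hg' : ∀ i j, g i j = g j i) (hb : ∀ u w, b u w = true → dfsPos g w < dfsPos g u) :
    forwardGraph (orientPlusBack g b) = g := by
  have hb' : ∀ u w, dfsPos g u < dfsPos g w → b u w = false := by
    intro u w h
    by_contra hc
    exact absurd (hb u w (by simpa using hc)) h.asymm
  funext u w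
  simp only [forwardGraph, dfsPos_orientPlusBack hb]
  rcases lt_trichotomy (dfsPos g u) (dfsPos g w) with h | h | h
  · simp [orientPlusBack, h, hb' u w h]
  · obtain rfl := dfsPos_injective g h
    simp [hg]
  · simp [orientPlusBack, h, h.asymm, hb' w u h, hg' u w]

theorem backEdges_orientPlusBack {g b : Fin n → Fin n → Bool}
    (hb : ∀ u w, b u w = true → dfsPos g w < dfsPos g u) :
    backEdges (orientPlusBack g b) = b := by
  funext u w
  simp only [backEdges, dfsPos_orientPlusBack hb, orientPlusBack]
  by_cases h : dfsPos g w < dfsPos g u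
  · simp [h, h.asymm]
  · have : b u w = false := by
      by_contra hc
      exact h (hb u w (by simpa using hc))
    simp [h, this]

theorem orientPlusBack_irrefl {g b : Fin n → Fin n → Bool}
    (hb : ∀ u w, b u w = true → dfsPos g w < dfsPos g u) (i : Fin n) :
    orientPlusBack g b i i = false := by
  have : b i i = false := by
    by_contra hc
    exact lt_irrefl _ (hb i i (by simpa using hc))
  simp [orientPlusBack, this]

/-- A product of a symmetric function over unordered pairs does not depend on the linear
order used to orient the pairs. -/
theorem prod_filter_lt_eq_of_symm {M α β γ : Type*} [CommMonoid M] [Fintype α]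
    [LinearOrder β] [LinearOrder γ] {q : α → β} {r : α → γ} (hq : Function.Injective q)
    (hr : Function.Injective r) (f : α → α → M) (hf : ∀ a b, f a b = f b a) :
    ∏ x ∈ univ.filter (fun x : α × α => q x.1 < q x.2), f x.1 x.2
      = ∏ x ∈ univ.filter (fun x : α × α => r x.1 < r x.2), f x.1 x.2 := by
  have hne : ∀ {a b : α}, q a < q b → ¬ r a < r b → r b < r a := by
    intro a b h h'
    exact lt_of_le_of_ne (not_lt.mp h') fun e => h.ne' (congrArg q (hr e))
  have hne' : ∀ {a b : α}, r a < r b → ¬ q a < q b → q b < q a := by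
    intro a b h h'
    exact lt_of_le_of_ne (not_lt.mp h') fun e => h.ne' (congrArg r (hq e))
  refine Finset.prod_bij' (fun x _ => if r x.1 < r x.2 then x else x.swap)
    (fun x _ => if q x.1 < q x.2 then x else x.swap) ?_ ?_ ?_ ?_ ?_
  · rintro ⟨a, b⟩ h
    simp only [mem_filter, mem_univ, true_and] at h ⊢
    split_ifs with h'
    · exact h'
    · exact hne h h'
  · rintro ⟨a, b⟩ h
    simp only [mem_filter, mem_univ, true_and] at h ⊢
    split_ifs with h'
    · exact h'
    · exact hne' h h'
  · rintro ⟨a, b⟩ h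
    simp only [mem_filter, mem_univ, true_and] at h
    by_cases h' : r a < r b <;> simp [h, h', h.asymm]
  · rintro ⟨a, b⟩ h
    simp only [mem_filter, mem_univ, true_and] at h
    by_cases h' : q a < q b <;> simp [h, h', h.asymm]
  · rintro ⟨a, b⟩ -
    dsimp only
    split_ifs
    · rfl
    · exact hf a b

theorem dirProb_eq_mul {d : Fin n → Fin n → Bool} (hd : ∀ i, d i i = false) (p : ℝ) :
    dirProb n p d = undirProb n p (forwardGraph d) * backProb n p (forwardGraph d)
      (backEdges d) := by
  have hback : ∀ u w, backEdges d u w = true → dfsPos d w < dfsPos d u := by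
    intro u w h
    simp only [backEdges, Bool.and_eq_true, decide_eq_true_eq] at h
    exact h.1
  rw [dirProb, if_pos hd, undirProb, if_pos ⟨forwardGraph_irrefl d, forwardGraph_symm d⟩,
    backProb, dfsPos_forwardGraph, if_pos hback]
  have hsymm : ∏ x ∈ univ.filter (fun x : Fin n × Fin n => x.1 < x.2),
        (if forwardGraph d x.1 x.2 then p else 1 - p)
      = ∏ x ∈ univ.filter (fun x : Fin n × Fin n => dfsPos d x.1 < dfsPos d x.2),
        (if forwardGraph d x.1 x.2 then p else 1 - p) :=
    prod_filter_lt_eq_of_symm (q := fun u : Fin n => u) Function.injective_id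
      (dfsPos_injective d) (fun u w => if forwardGraph d u w then p else 1 - p)
      (fun u w => by rw [forwardGraph_symm d u w])
  have hfwd : ∏ x ∈ univ.filter (fun x : Fin n × Fin n => dfsPos d x.1 < dfsPos d x.2),
        (if forwardGraph d x.1 x.2 then p else 1 - p)
      = ∏ x ∈ univ.filter (fun x : Fin n × Fin n => dfsPos d x.1 < dfsPos d x.2),
        (if d x.1 x.2 then p else 1 - p) := by
    refine Finset.prod_congr rfl fun x hx => ?_
    simp [forwardGraph, (mem_filter.mp hx).2]
  have hbwd : ∏ x ∈ univ.filter (fun x : Fin n × Fin n => dfsPos d x.2 < dfsPos d x.1),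
        (if backEdges d x.1 x.2 then p else 1 - p)
      = ∏ x ∈ univ.filter (fun x : Fin n × Fin n => dfsPos d x.2 < dfsPos d x.1),
        (if d x.1 x.2 then p else 1 - p) := by
    refine Finset.prod_congr rfl fun x hx => ?_
    simp [backEdges, (mem_filter.mp hx).2]
  rw [hsymm, hfwd, hbwd, ← Finset.prod_union]
  · congr 1
    ext x
    simp only [mem_filter, mem_univ, true_and, mem_union]
    rw [← (dfsPos_injective d).ne_iff, lt_or_lt_iff_ne]
  · rw [Finset.disjoint_filter]
    exact fun x _ h => h.asymm

end DFSExploration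

open DFSExploration in
/-- For every `n` and `p ∈ [0,1]`, the law of `G⃗(n,p)` equals the law of
the random directed graph obtained by: sampling `G(n,p)`; orienting each of its edges in
the increasing direction of the depth-first order `v₀, …, v_{n-1}` of its depth-first
exploration; and then adding each possible back edge `(vᵢ, vⱼ)`, `j < i`, independently
with probability `p`. -/
theorem directed_graph_coupling_distribution
    (n : ℕ) (p : ℝ) (hp0 : 0 ≤ p) (hp1 : p ≤ 1)
    (d : Fin n → Fin n → Bool) :
    dirProb n p d
      = ∑ g : Fin n → Fin n → Bool, ∑ b : Fin n → Fin n → Bool,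
          undirProb n p g * backProb n p g b *
            (if orientPlusBack g b = d then 1 else 0) := by
  have key : ∀ g b : Fin n → Fin n → Bool,
      undirProb n p g * backProb n p g b * (if orientPlusBack g b = d then 1 else 0) ≠ 0 →
      (∀ i, d i i = false) ∧ g = forwardGraph d ∧ b = backEdges d := by
    intro g b h
    have hu : undirProb n p g ≠ 0 := left_ne_zero_of_mul (left_ne_zero_of_mul h)
    have hk : backProb n p g b ≠ 0 := right_ne_zero_of_mul (left_ne_zero_of_mul h)
    have ho := (ite_ne_right_iff.mp (right_ne_zero_of_mul h)).1
    have hg := (ite_ne_right_iff.mp hu).1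
    have hb := (ite_ne_right_iff.mp hk).1
    subst ho
    exact ⟨orientPlusBack_irrefl hb, (forwardGraph_orientPlusBack hg.1 hg.2 hb).symm,
      (backEdges_orientPlusBack hb).symm⟩
  by_cases hd : ∀ i, d i i = false
  · rw [Fintype.sum_eq_single (forwardGraph d), Fintype.sum_eq_single (backEdges d),
      if_pos (orientPlusBack_forwardGraph hd), mul_one, dirProb_eq_mul hd]
    · intro b hb
      by_contra h
      exact hb (key _ _ h).2.2
    · intro g hg
      refine Finset.sum_eq_zero fun b _ => ?_
      by_contra h
      exact hg (key _ _ h).2.1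
  · rw [dirProb, if_neg hd]
    symm
    refine Finset.sum_eq_zero fun g _ => Finset.sum_eq_zero fun b _ => ?_
    by_contra h
    exact hd (key _ _ h).1
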